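/- arXiv:1804.06132 — 6 statements merged into one kernel-verified Lean document; each statement's English description precedes it below -/
import Mathlib

section
/- Let p and q be distinct primes and r ≥ 1. The map φ ↦ φ(1) is a bijection between the set of continuous group homomorphisms from the additive topological group ℤ_q of q-adic integers to GL_r(ℤ_p) and the set of elements of GL_r(ℤ_p) of q-power order (i.e., matrices U with U^{q^m} = 1 for some m ≥ 0). -/
/-- If `V ≡ 1` modulo `p` and `V ^ N ≡ 1` modulo `p ^ (k + 1)` for an `N` prime to `p`, then
a congruence `V ≡ 1` modulo `p ^ k` can be improved to `p ^ (k + 1)`. -/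
theorem natCast_pow_succ_dvd_sub_one {R : Type*} [Ring R] {p N k : ℕ} (hN : N.Coprime p) {V : R}
    (hV : (p : R) ∣ V - 1) (hk : ((p ^ k : ℕ) : R) ∣ V - 1)
    (hVN : ((p ^ (k + 1) : ℕ) : R) ∣ V ^ N - 1) : ((p ^ (k + 1) : ℕ) : R) ∣ V - 1 := by
  have hpow (n : ℕ) : (p : R) ∣ V ^ n - 1 := by
    rw [← mul_geom_sum]
    exact hV.mul_right _
  have hsum : (p : R) ∣ (∑ i ∈ Finset.range N, V ^ i) - N := by
    have h : (∑ i ∈ Finset.range N, V ^ i) - N = ∑ i ∈ Finset.range N, (V ^ i - 1) := by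
      simp [Finset.sum_sub_distrib]
    rw [h]
    exact Finset.dvd_sum fun i _ => hpow i
  have hmul : ((p ^ (k + 1) : ℕ) : R) ∣ N * (V - 1) := by
    obtain ⟨B, hB⟩ := hsum
    obtain ⟨A, hA⟩ := hk
    have h : N * (V - 1) = (V ^ N - 1) - ((p ^ (k + 1) : ℕ) : R) * (A * B) := by
      rw [← mul_geom_sum, sub_eq_iff_eq_add.mp hB, mul_add, (Nat.cast_commute N (V - 1)).eq,
        ← mul_assoc (V - 1) (p : R), ← (Nat.cast_commute p (V - 1)).eq, hA, pow_succ',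
        Nat.cast_mul]
      noncomm_ring
    rw [h]
    exact dvd_sub hVN (dvd_mul_right _ _)
  obtain ⟨u, v, huv⟩ := Nat.isCoprime_iff_coprime.mpr (hN.pow_right (k + 1))
  have h : V - 1 = N * (V - 1) * u + ((p ^ (k + 1) : ℕ) : R) * (v * (V - 1)) := by
    have huv' := congrArg (Int.cast : ℤ → R) huv
    push_cast at huv' ⊢
    rw [← (Int.cast_commute u _).eq, ← mul_assoc, ← mul_assoc, ← (Int.cast_commute v _).eq,
      ← add_mul, huv', one_mul]
  rw [h]
  exact dvd_add (hmul.mul_right _) (dvd_mul_right _ _)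

/-- Divisibility of a `p`-adic matrix by `p ^ k` is tested on the norms of its entries. -/
theorem Matrix.natCast_pow_dvd_iff_norm_le {p : ℕ} [Fact p.Prime] {n : Type*} [Fintype n]
    [DecidableEq n] (k : ℕ) (M : Matrix n n ℤ_[p]) :
    ((p ^ k : ℕ) : Matrix n n ℤ_[p]) ∣ M ↔ ∀ i j, ‖M i j‖ ≤ (p : ℝ) ^ (-k : ℤ) := by
  simp only [PadicInt.norm_le_pow_iff_mem_span_pow, Ideal.mem_span_singleton]
  constructor
  · rintro ⟨A, rfl⟩ i j
    rw [← nsmul_eq_mul]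
    exact ⟨A i j, by simp⟩
  · intro h
    choose A hA using h
    refine ⟨Matrix.of A, ?_⟩
    ext i j
    rw [← nsmul_eq_mul, hA]
    simp

/-- A matrix whose `q ^ n`-th powers tend to `1` in `GL_r(ℤ_p)`, with `q` a unit in `ℤ_p`, has
`q`-power order. -/
theorem exists_pow_pow_eq_one_of_tendsto {p q : ℕ} [Fact p.Prime] (hqp : q.Coprime p)
    {n : Type*} [Fintype n] [DecidableEq n] (U : GL n ℤ_[p])
    (hU : Filter.Tendsto (fun m : ℕ => U ^ q ^ m) Filter.atTop (nhds 1)) :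
    ∃ m : ℕ, U ^ q ^ m = 1 := by
  have hdvd (k : ℕ) : ∀ᶠ m : ℕ in Filter.atTop,
      ((p ^ k : ℕ) : Matrix n n ℤ_[p]) ∣ (U : Matrix n n ℤ_[p]) ^ q ^ m - 1 := by
    simp only [Matrix.natCast_pow_dvd_iff_norm_le, Filter.eventually_all]
    intro i j
    have hval : Filter.Tendsto (fun m : ℕ => ((U ^ q ^ m : GL n ℤ_[p]) : Matrix n n ℤ_[p]) i j)
        Filter.atTop (nhds ((1 : Matrix n n ℤ_[p]) i j)) :=
      ((Units.continuous_val.matrix_elem i j).tendsto 1).comp hU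
    have hpos : (0 : ℝ) < (p : ℝ) ^ (-k : ℤ) :=
      zpow_pos (by exact_mod_cast (Fact.out : p.Prime).pos) _
    filter_upwards [Metric.tendsto_nhds.mp hval _ hpos] with m hm
    simpa [dist_eq_norm] using hm.le
  obtain ⟨m, hm⟩ := (hdvd 1).exists
  rw [pow_one] at hm
  refine ⟨m, ?_⟩
  have hall (k : ℕ) :
      ((p ^ k : ℕ) : Matrix n n ℤ_[p]) ∣ (U : Matrix n n ℤ_[p]) ^ q ^ m - 1 := by
    induction k with
    | zero => simp
    | succ k ih =>
      obtain ⟨l, hl, hml⟩ := ((hdvd (k + 1)).and (Filter.eventually_ge_atTop m)).exists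
      refine natCast_pow_succ_dvd_sub_one (hqp.pow_left (l - m)) hm ih ?_
      rwa [← pow_mul, ← pow_add, Nat.add_sub_cancel' hml]
  ext i j
  have hzero : ((U : Matrix n n ℤ_[p]) ^ q ^ m - 1) i j = 0 := by
    rw [← PadicInt.ext_of_toZModPow]
    intro k
    rw [map_zero, ← RingHom.mem_ker, PadicInt.ker_toZModPow,
      ← PadicInt.norm_le_pow_iff_mem_span_pow]
    exact (Matrix.natCast_pow_dvd_iff_norm_le k _).mp (hall k) i j
  simpa [sub_eq_zero] using hzero

/-- Continuous homomorphisms out of `ℤ_q` are determined by their value at `1`. -/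
theorem PadicInt.continuousMonoidHom_eval_one_injective (q : ℕ) [Fact q.Prime] (G : Type*)
    [Group G] [TopologicalSpace G] [T2Space G] :
    Function.Injective (fun φ : ContinuousMonoidHom (Multiplicative ℤ_[q]) G =>
      φ (Multiplicative.ofAdd (1 : ℤ_[q]))) := by
  intro φ ψ h
  have hext : (fun x : ℤ_[q] => φ (Multiplicative.ofAdd x)) =
      fun x => ψ (Multiplicative.ofAdd x) := by
    refine (PadicInt.denseRange_natCast (p := q)).equalizer
      (φ.continuous_toFun.comp continuous_ofAdd) (ψ.continuous_toFun.comp continuous_ofAdd) ?_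
    funext n
    have hn : Multiplicative.ofAdd (n : ℤ_[q]) = Multiplicative.ofAdd (1 : ℤ_[q]) ^ n := by
      rw [← ofAdd_nsmul, nsmul_one]
    simpa [hn] using congrArg (· ^ n) h
  ext x
  exact congrFun hext x.toAdd

/-- An element of `q`-power order is the value at `1` of a continuous homomorphism from `ℤ_q`. -/
theorem PadicInt.exists_continuousMonoidHom_eval_one_eq {q : ℕ} [Fact q.Prime] {G : Type*}
    [Group G] [TopologicalSpace G] [IsTopologicalGroup G] {g : G} {m : ℕ} (hg : g ^ q ^ m = 1) :
    ∃ φ : ContinuousMonoidHom (Multiplicative ℤ_[q]) G,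
      φ (Multiplicative.ofAdd (1 : ℤ_[q])) = g := by
  let f : ZMod (q ^ m) →+ Additive G :=
    ZMod.lift (q ^ m) ⟨zmultiplesHom (Additive G) (Additive.ofMul g), by
      simp only [zmultiplesHom_apply, natCast_zsmul]
      exact hg⟩
  let φ : Multiplicative ℤ_[q] →* G :=
    AddMonoidHom.toMultiplicativeLeft (f.comp (toZModPow m).toAddMonoidHom)
  refine ⟨⟨φ, continuous_of_continuousAt_one φ ?_⟩, ?_⟩
  · refine ContinuousAt.congr (f := fun _ => 1) continuousAt_const ?_
    have hball : Metric.ball (0 : ℤ_[q]) ((q : ℝ) ^ (-m : ℤ)) ∈ nhds (0 : ℤ_[q]) :=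
      Metric.ball_mem_nhds _ (zpow_pos (by exact_mod_cast (Fact.out : q.Prime).pos) _)
    filter_upwards [continuous_toAdd.continuousAt.preimage_mem_nhds
      (x := (1 : Multiplicative ℤ_[q])) hball] with x hx
    have hx0 : toZModPow m x.toAdd = 0 := by
      rw [← RingHom.mem_ker, ker_toZModPow, ← norm_le_pow_iff_mem_span_pow]
      exact (mem_ball_zero_iff.mp hx).le
    change 1 = (f (toZModPow m x.toAdd)).toMul
    rw [hx0, map_zero, toMul_zero]
  · change (f (toZModPow m 1)).toMul = g
    rw [map_one, ← Int.cast_one]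
    simp only [f, ZMod.lift_coe]
    simp

/-- For distinct primes `p ≠ q`, the map `φ ↦ φ(1)` is a bijection between continuous
homomorphisms from the additive group `ℤ_q` to `GL_r(ℤ_p)` and the elements of
`GL_r(ℤ_p)` of `q`-power order. -/
theorem continuousHom_zq_GL_bijection (p q : ℕ) [Fact p.Prime] [Fact q.Prime]
    (hpq : p ≠ q) (r : ℕ) (hr : 1 ≤ r) :
    Function.Injective
        (fun φ : ContinuousMonoidHom (Multiplicative ℤ_[q]) (GL (Fin r) ℤ_[p]) =>
          φ (Multiplicative.ofAdd (1 : ℤ_[q]))) ∧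
      Set.range
          (fun φ : ContinuousMonoidHom (Multiplicative ℤ_[q]) (GL (Fin r) ℤ_[p]) =>
            φ (Multiplicative.ofAdd (1 : ℤ_[q]))) =
        {U : GL (Fin r) ℤ_[p] | ∃ m : ℕ, U ^ q ^ m = 1} := by
  refine ⟨PadicInt.continuousMonoidHom_eval_one_injective q _, Set.Subset.antisymm ?_ ?_⟩
  · rintro _ ⟨φ, rfl⟩
    refine exists_pow_pow_eq_one_of_tendsto
      ((Nat.coprime_primes Fact.out Fact.out).mpr hpq.symm) _ ?_
    have hq : Filter.Tendsto (fun m : ℕ => (q : ℤ_[q]) ^ m) Filter.atTop (nhds 0) :=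
      tendsto_pow_atTop_nhds_zero_of_norm_lt_one (by
        rw [PadicInt.norm_p]
        exact inv_lt_one_of_one_lt₀ (by exact_mod_cast (Fact.out : q.Prime).one_lt))
    have hφ := ((φ.continuous_toFun.comp continuous_ofAdd).tendsto 0).comp hq
    have hone : (φ.toFun ∘ Multiplicative.ofAdd) (0 : ℤ_[q]) = 1 := map_one φ
    rw [hone] at hφ
    refine hφ.congr fun m => ?_
    change φ (Multiplicative.ofAdd ((q : ℤ_[q]) ^ m)) = _
    rw [← map_pow, ← ofAdd_nsmul, nsmul_one, Nat.cast_pow]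
  · rintro U ⟨m, hm⟩
    exact PadicInt.exists_continuousMonoidHom_eval_one_eq hm
end

section
/- Let p be a prime and r ≥ 1. The map φ ↦ φ(1) is a bijection between the set of continuous group homomorphisms from the additive topological group ℤ_p of p-adic integers to GL_r(ℤ_p) and the set of matrices U ∈ GL_r(ℤ_p) whose reduction modulo p has p-power order in GL_r(ℤ/pℤ). -/
open Filter Topology

namespace Matrix

variable {n R : Type*} [Fintype n]

attribute [local instance] Matrix.normedAddCommGroup

/-- The entrywise sup norm is submultiplicative on matrices over an ultrametric normed ring. -/
theorem norm_mul_le_of_isUltrametricDist [NormedRing R] [IsUltrametricDist R]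
    (A B : Matrix n n R) : ‖A * B‖ ≤ ‖A‖ * ‖B‖ := by
  refine (Matrix.norm_le_iff (by positivity)).2 fun i j => ?_
  rw [Matrix.mul_apply]
  refine IsUltrametricDist.norm_sum_le_of_forall_le_of_nonneg (by positivity) fun k _ => ?_
  exact (norm_mul_le _ _).trans
    (mul_le_mul (norm_entry_le_entrywise_sup_norm A) (norm_entry_le_entrywise_sup_norm B)
      (norm_nonneg _) (norm_nonneg _))

/-- The normed ring structure given by the entrywise sup norm on square matrices over an
ultrametric normed ring. -/
noncomputable abbrev ultrametricNormedRing [DecidableEq n] [NormedRing R] [IsUltrametricDist R] :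
    NormedRing (Matrix n n R) :=
  { Matrix.normedAddCommGroup, Matrix.instRing with
    norm_mul_le := norm_mul_le_of_isUltrametricDist }

/-- Over a ring of prime characteristic `p`, a matrix is unipotent iff some `p`-power power of it
is the identity. -/
theorem exists_pow_prime_pow_eq_one_iff [DecidableEq n] [Nonempty n] [CommRing R] (p : ℕ)
    [Fact p.Prime] [CharP R p] (A : Matrix n n R) :
    (∃ m : ℕ, A ^ p ^ m = 1) ↔ IsNilpotent (A - 1) := by
  have key (m : ℕ) : (A - 1) ^ p ^ m = A ^ p ^ m - 1 := by
    rw [sub_pow_char_pow_of_commute p m (Commute.one_right A), one_pow]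
  constructor
  · rintro ⟨m, hm⟩
    exact ⟨p ^ m, by rw [key, hm, sub_self]⟩
  · rintro ⟨k, hk⟩
    refine ⟨k, ?_⟩
    have := pow_eq_zero_of_le (Nat.lt_pow_self (Fact.out : p.Prime).one_lt).le hk
    rwa [key, sub_eq_zero] at this

end Matrix

/-- In a normed ring, an element with a power of norm less than one is topologically nilpotent. -/
theorem tendsto_pow_zero_of_norm_pow_lt_one {R : Type*} [NormedRing R] {a : R} {k : ℕ}
    (h : ‖a ^ k‖ < 1) : Tendsto (a ^ ·) atTop (𝓝 0) := by
  rcases Nat.eq_zero_or_pos k with rfl | hk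
  · rw [pow_zero] at h
    have : ‖(1 : R)‖ = 0 := by
      have h1 := norm_mul_le (1 : R) 1
      rw [mul_one] at h1
      nlinarith [norm_nonneg (1 : R)]
    have h0 (x : R) : x = 0 := by rw [← mul_one x, norm_eq_zero.1 this, mul_zero]
    simpa only [h0] using tendsto_const_nhds
  · have hdiv : Tendsto (fun n : ℕ => n / k) atTop atTop :=
      Nat.tendsto_div_const_atTop hk.ne'
    have hmain : Tendsto (fun n : ℕ => (a ^ k) ^ (n / k)) atTop (𝓝 0) :=
      (tendsto_pow_atTop_nhds_zero_of_norm_lt_one h).comp hdiv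
    refine (hmain.zero_mul_isBoundedUnder_le (g := fun n => a ^ (n % k)) ?_).congr fun n => ?_
    · refine isBoundedUnder_of ⟨∑ i ∈ Finset.range k, ‖a ^ i‖, fun n => ?_⟩
      exact Finset.single_le_sum (f := fun i => ‖a ^ i‖) (fun _ _ => norm_nonneg _)
        (Finset.mem_range.2 (Nat.mod_lt n hk))
    · rw [← pow_mul, ← pow_add, Nat.div_add_mod]

namespace PadicInt

variable {p : ℕ} [Fact p.Prime] {n : Type*} [Fintype n]

theorem toZMod_eq_zero_iff_norm_lt_one {x : ℤ_[p]} : toZMod x = 0 ↔ ‖x‖ < 1 := by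
  rw [← RingHom.mem_ker, ker_toZMod, IsLocalRing.mem_maximalIdeal, mem_nonunits]

attribute [local instance] Matrix.normedAddCommGroup in
theorem map_toZMod_eq_zero_iff_norm_lt_one {A : Matrix n n ℤ_[p]} :
    A.map toZMod = 0 ↔ ‖A‖ < 1 := by
  simp only [Matrix.norm_lt_iff one_pos, ← toZMod_eq_zero_iff_norm_lt_one, ← Matrix.ext_iff,
    Matrix.map_apply, Matrix.zero_apply]

attribute [local instance] Matrix.ultrametricNormedRing in
/-- A `p`-adic matrix is topologically nilpotent iff its reduction modulo `p` is nilpotent. -/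
theorem tendsto_matrix_pow_zero_iff [DecidableEq n] {A : Matrix n n ℤ_[p]} :
    Tendsto (A ^ ·) atTop (𝓝 0) ↔ IsNilpotent (A.map (toZMod (p := p))) := by
  have key (k : ℕ) : (A.map (toZMod (p := p))) ^ k = 0 ↔ ‖A ^ k‖ < 1 := by
    rw [← Matrix.map_pow]
    exact map_toZMod_eq_zero_iff_norm_lt_one
  constructor
  · intro h
    obtain ⟨k, hk⟩ := (h.norm.eventually_lt_const (by simp : ‖(0 : Matrix n n ℤ_[p])‖ < 1)).exists
    exact ⟨k, (key k).2 hk⟩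
  · rintro ⟨k, hk⟩
    exact tendsto_pow_zero_of_norm_pow_lt_one ((key k).1 hk)

attribute [local instance] Matrix.ultrametricNormedRing in
/-- A `p`-adic matrix is the value at `1` of a continuous additive character of `ℤ_[p]` iff its
difference with the identity is topologically nilpotent. -/
theorem exists_continuous_addChar_matrix_iff [DecidableEq n] {A : Matrix n n ℤ_[p]} :
    (∃ κ : AddChar ℤ_[p] (Matrix n n ℤ_[p]), Continuous κ ∧ κ 1 = A) ↔
      Tendsto ((A - 1) ^ ·) atTop (𝓝 0) := by
  have : IsUltrametricDist (Matrix n n ℤ_[p]) :=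
    inferInstanceAs (IsUltrametricDist (n → n → ℤ_[p]))
  have : @CompleteSpace (Matrix n n ℤ_[p]) PseudoMetricSpace.toUniformSpace :=
    inferInstanceAs (CompleteSpace (n → n → ℤ_[p]))
  have : IsBoundedSMul ℤ_[p] (Matrix n n ℤ_[p]) :=
    inferInstanceAs (IsBoundedSMul ℤ_[p] (n → n → ℤ_[p]))
  constructor
  · rintro ⟨κ, hκ, rfl⟩
    exact AddChar.tendsto_eval_one_sub_pow hκ
  · intro h
    exact ⟨addChar_of_value_at_one (A - 1) h, continuous_addChar_of_value_at_one h,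
      (addChar_of_value_at_one_def h).trans (add_sub_cancel 1 A)⟩

end PadicInt

/-- A continuous homomorphism from a topological group to a topological monoid takes values in the
units, continuously for the units topology. -/
def ContinuousMonoidHom.toHomUnits {G M : Type*} [Group G] [TopologicalSpace G] [ContinuousInv G]
    [Monoid M] [TopologicalSpace M] (f : G →ₜ* M) : G →ₜ* Mˣ where
  toMonoidHom := f.toMonoidHom.toHomUnits
  continuous_toFun := Units.continuous_iff.2
    ⟨f.continuous_toFun, f.continuous_toFun.comp continuous_inv⟩


/-- The map `φ ↦ φ(1)` is a bijection between continuous homomorphisms from the additive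
group `ℤ_p` to `GL_r(ℤ_p)` and the matrices `U ∈ GL_r(ℤ_p)` whose reduction mod `p` has
`p`-power order in `GL_r(ℤ/pℤ)`. -/
theorem continuousHom_zp_GL_bijection (p : ℕ) [Fact p.Prime] (r : ℕ) (hr : 1 ≤ r) :
    Function.Injective
        (fun φ : ContinuousMonoidHom (Multiplicative ℤ_[p]) (GL (Fin r) ℤ_[p]) =>
          φ (Multiplicative.ofAdd (1 : ℤ_[p]))) ∧
      Set.range
          (fun φ : ContinuousMonoidHom (Multiplicative ℤ_[p]) (GL (Fin r) ℤ_[p]) =>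
            φ (Multiplicative.ofAdd (1 : ℤ_[p]))) =
        {U : GL (Fin r) ℤ_[p] | ∃ m : ℕ,
          (Matrix.GeneralLinearGroup.map (PadicInt.toZMod (p := p)) U) ^ p ^ m = 1} := by
  have : Nonempty (Fin r) := ⟨⟨0, hr⟩⟩
  constructor
  · intro φ ψ h
    let κ (f : ContinuousMonoidHom (Multiplicative ℤ_[p]) (GL (Fin r) ℤ_[p])) :
        AddChar ℤ_[p] (GL (Fin r) ℤ_[p]) := AddChar.toMonoidHomEquiv.symm f.toMonoidHom
    have hκ : κ φ = κ ψ := PadicInt.denseRange_natCast.addChar_eq_of_eval_one_eq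
      φ.continuous_toFun ψ.continuous_toFun h
    ext1 x
    exact DFunLike.congr_fun hκ x.toAdd
  · ext U
    have hred : (∃ m : ℕ, (Matrix.GeneralLinearGroup.map (PadicInt.toZMod (p := p)) U) ^ p ^ m = 1)
        ↔ Tendsto ((U.val - 1) ^ ·) atTop (𝓝 0) := by
      rw [PadicInt.tendsto_matrix_pow_zero_iff,
        Matrix.map_sub _ (map_sub _), Matrix.map_one _ (map_zero _) (map_one _),
        ← Matrix.exists_pow_prime_pow_eq_one_iff p]
      simp only [Units.ext_iff, Units.val_pow_eq_pow_val, Units.val_one]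
      rfl
    rw [Set.mem_ofPred_eq, hred, ← PadicInt.exists_continuous_addChar_matrix_iff]
    constructor
    · rintro ⟨φ, rfl⟩
      exact ⟨AddChar.toMonoidHomEquiv.symm ((Units.coeHom _).comp φ.toMonoidHom),
        Units.continuous_val.comp φ.continuous_toFun, rfl⟩
    · rintro ⟨κ, hκ, hU⟩
      exact ⟨ContinuousMonoidHom.toHomUnits ⟨κ.toMonoidHom, hκ⟩, Units.ext hU⟩
end

section
/- Let p be a prime, r ≥ 1, and set s = s(r) = r(r−1)/2. If U ∈ GL_r(ℤ_p) satisfies U^{p^s} ≡ 1 (mod p), then for every n ≥ 1 one has U^{p^{s+(n−1)r²}} ≡ 1 (mod p^n). -/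
/-- In a possibly noncommutative ring, raising to the `p ^ k`-th power improves a congruence to `1`
modulo `p` to one modulo `p ^ (k + 1)`. -/
theorem natCast_pow_succ_dvd_pow_prime_pow_sub_one {R : Type*} [Ring R] {p : ℕ} (hp : p.Prime)
    {a : R} (h : (p : R) ∣ a - 1) (k : ℕ) : (p : R) ^ (k + 1) ∣ a ^ p ^ k - 1 := by
  induction k with
  | zero => simpa using h
  | succ k ih =>
    obtain ⟨c, hc⟩ := ih
    obtain ⟨t, ht⟩ := (Commute.one_left ((p : R) ^ (k + 1) * c)).exists_add_pow_prime_eq hp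
    rw [pow_succ p k, pow_mul, sub_eq_iff_eq_add'.mp hc, ht, one_pow, add_assoc (1 : R),
      add_sub_cancel_left, mul_one]
    refine dvd_add ?_ ⟨c * t, by simp only [pow_succ', mul_assoc]⟩
    rw [((Nat.cast_commute p c).pow_left (k + 1)).mul_pow, ← pow_mul]
    exact Dvd.dvd.mul_right (pow_dvd_pow _ (by nlinarith [hp.two_le])) _

/-- A natural number divides a matrix iff it divides all of its entries. -/
theorem Matrix.natCast_dvd_iff {n R : Type*} [Fintype n] [DecidableEq n] [CommRing R] (m : ℕ)
    (A : Matrix n n R) : (m : Matrix n n R) ∣ A ↔ ∀ i j, (m : R) ∣ A i j := by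
  constructor
  · rintro ⟨B, rfl⟩ i j
    rw [← nsmul_eq_mul, Matrix.smul_apply, nsmul_eq_mul]
    exact dvd_mul_right _ _
  · intro h
    choose B hB using h
    refine ⟨Matrix.of B, ?_⟩
    ext i j
    rw [← nsmul_eq_mul, hB, Matrix.smul_apply, nsmul_eq_mul, Matrix.of_apply]

/-- If `U ∈ GL_r(ℤ_p)` satisfies `U^(p^s) ≡ 1 (mod p)` with `s = r(r-1)/2`, then for every
`n ≥ 1` one has `U^(p^(s+(n-1)r²)) ≡ 1 (mod p^n)` (congruences taken entrywise). -/
theorem GL_padicInt_pow_congr (p : ℕ) [Fact p.Prime] (r : ℕ) (hr : 1 ≤ r)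
    (U : GL (Fin r) ℤ_[p])
    (hU : ∀ i j : Fin r,
      (p : ℤ_[p]) ∣
        (((U ^ p ^ (r * (r - 1) / 2) : GL (Fin r) ℤ_[p]) : Matrix (Fin r) (Fin r) ℤ_[p]) i j -
          (1 : Matrix (Fin r) (Fin r) ℤ_[p]) i j)) :
    ∀ n : ℕ, 1 ≤ n → ∀ i j : Fin r,
      (p : ℤ_[p]) ^ n ∣
        (((U ^ p ^ (r * (r - 1) / 2 + (n - 1) * r ^ 2) : GL (Fin r) ℤ_[p]) :
            Matrix (Fin r) (Fin r) ℤ_[p]) i j -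
          (1 : Matrix (Fin r) (Fin r) ℤ_[p]) i j) := by
  intro n hn i j
  have hdvd : (p : Matrix (Fin r) (Fin r) ℤ_[p]) ∣ (U.val ^ p ^ (r * (r - 1) / 2)) - 1 := by
    rw [Matrix.natCast_dvd_iff]
    simpa only [Units.val_pow_eq_pow_val, Matrix.sub_apply] using hU
  have hpow := natCast_pow_succ_dvd_pow_prime_pow_sub_one (Fact.out : p.Prime) hdvd
    ((n - 1) * r ^ 2)
  have hle : n ≤ (n - 1) * r ^ 2 + 1 := by
    have := Nat.le_mul_of_pos_right (n - 1) (pow_pos hr 2)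
    lia
  have hn_dvd := (pow_dvd_pow _ hle).trans hpow
  rw [← pow_mul, ← pow_add, ← Nat.cast_pow, Matrix.natCast_dvd_iff] at hn_dvd
  simpa only [Units.val_pow_eq_pow_val, Matrix.sub_apply, Nat.cast_pow] using hn_dvd i j
end

section
/- Let p be a prime, let k̄ be an algebraic closure of the field with p elements, let W = W(k̄) be the ring of p-typical Witt vectors of k̄, and let φ : W → W be the ring automorphism induced functorially by the Frobenius x ↦ x^p of k̄ (acting entrywise on matrices). Let u ∈ GL_r(ℤ_p) and let U ∈ GL_r(W) be its image under the canonical embedding ℤ_p ≅ W(𝔽_p) → W(k̄). Then there exists a matrix ε ∈ GL_r(W) such that φ(ε)⁻¹ · ε = U⁻¹. -/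
open WittVector

/-- The ring of Witt vectors of an algebraic closure of `𝔽_p`. -/
noncomputable abbrev WittBar (p : ℕ) [Fact p.Prime] : Type _ :=
  WittVector p (AlgebraicClosure (ZMod p))

/-- The Frobenius of `W(k̄)`, induced functorially by `x ↦ x^p` on `k̄`. -/
noncomputable abbrev wittFrob (p : ℕ) [Fact p.Prime] : WittBar p →+* WittBar p :=
  WittVector.map (frobenius (AlgebraicClosure (ZMod p)) p)

/-- The canonical embedding `ℤ_p ≅ W(𝔽_p) → W(k̄)`. -/
noncomputable abbrev padicToWittBar (p : ℕ) [Fact p.Prime] : ℤ_[p] →+* WittBar p :=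
  (WittVector.map (algebraMap (ZMod p) (AlgebraicClosure (ZMod p)))).comp
    (WittVector.equiv p).symm.toRingHom

open Polynomial in
/-- A linearised polynomial of degree less than `p ^ n` vanishing on the field with `p ^ n` elements
has vanishing linear coefficient. -/
theorem eq_zero_of_sum_mul_pow_pow_eq_zero {K : Type*} [Field K] [IsAlgClosed K] (p : ℕ)
    [Fact p.Prime] [CharP K p] {n : ℕ} (hn : 0 < n) (a : ℕ → K)
    (h : ∀ c : K, c ^ p ^ n = c → ∑ i ∈ Finset.range n, c ^ p ^ i * a i = 0) : a 0 = 0 := by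
  have hp := (Fact.out : p.Prime).one_lt
  have hq : 1 < p ^ n := Nat.one_lt_pow hn.ne' hp
  have hcard : Fintype.card ((X ^ p ^ n - X : K[X]).rootSet K) = p ^ n := by
    rw [card_rootSet_eq_natDegree (galois_poly_separable p _ (dvd_pow_self p hn.ne'))
      (IsAlgClosed.splits _), FiniteField.X_pow_card_sub_X_natDegree_eq K hq]
  have hzero : ∑ i ∈ Finset.range n, C (a i) * X ^ p ^ i = (0 : K[X]) := by
    refine eq_zero_of_natDegree_lt_card_of_eval_eq_zero _
      (ι := (X ^ p ^ n - X : K[X]).rootSet K) Subtype.val_injective (fun c ↦ ?_) ?_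
    · have hc : (c : K) ^ p ^ n = c := by
        simpa [sub_eq_zero] using (mem_rootSet.1 c.2).2
      simp only [eval_finsetSum, eval_mul, eval_C, eval_pow, eval_X, mul_comm (a _)]
      exact h c hc
    · refine lt_of_le_of_lt (natDegree_sum_le_of_forall_le (n := p ^ (n - 1)) _ _ fun i hi ↦ ?_) ?_
      · refine (natDegree_C_mul_X_pow_le _ _).trans (Nat.pow_le_pow_right hp.le ?_)
        have := Finset.mem_range.1 hi
        omega
      · exact (Nat.pow_lt_pow_right hp (by omega)).trans_eq hcard.symm
  have hcoeff := congr_arg (Polynomial.coeff · 1) hzero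
  simp only [finsetSum_coeff, coeff_C_mul, coeff_X_pow, coeff_zero] at hcoeff
  rw [Finset.sum_eq_single 0] at hcoeff
  · simpa using hcoeff
  · intro i _ hi
    rw [if_neg (Nat.one_lt_pow hi hp).ne, mul_zero]
  · exact fun h0 ↦ absurd (Finset.mem_range.2 hn) h0

/-- A matrix of finite order over an algebraically closed field that is fixed by the Frobenius is
a Frobenius coboundary. -/
theorem exists_isUnit_map_frobenius_mul_eq {K : Type*} [Field K] [IsAlgClosed K] (p : ℕ)
    [Fact p.Prime] [CharP K p] {r n : ℕ} (hn : 0 < n) (B : Matrix (Fin r) (Fin r) K)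
    (hB : B.map (frobenius K p) = B) (hBn : B ^ n = 1) :
    ∃ e : Matrix (Fin r) (Fin r) K, IsUnit e ∧ e.map (frobenius K p) * B = e := by
  set S : Set (Fin r → K) := {v | Matrix.vecMul (frobenius K p ∘ v) B = v}
  have hS : Submodule.span K S = ⊤ := by
    by_contra hne
    obtain ⟨l, hl, hker⟩ := Submodule.exists_le_ker_of_lt_top _ (lt_top_iff_ne_top.2 hne)
    refine hl (LinearMap.pi_ext' fun j ↦ LinearMap.ext_ring ?_)
    set w : Fin r → K := Pi.single j 1
    have hw : frobenius K p ∘ w = w := by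
      ext i
      by_cases hij : i = j
      · subst hij; simp [w]
      · simp [w, hij]
    have hBi (i : ℕ) : (B ^ i).map (frobenius K p) = B ^ i := by
      simpa [hB] using map_pow (frobenius K p).mapMatrix B i
    suffices l (Matrix.vecMul w (B ^ 0)) = 0 by simpa [w] using this
    refine eq_zero_of_sum_mul_pow_pow_eq_zero p hn (fun i ↦ l (Matrix.vecMul w (B ^ i)))
      fun c hc ↦ ?_
    have hmem : ∑ i ∈ Finset.range n, c ^ p ^ i • Matrix.vecMul w (B ^ i) ∈ S := by
      have hfrob : frobenius K p ∘ (∑ i ∈ Finset.range n, c ^ p ^ i • Matrix.vecMul w (B ^ i)) =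
          ∑ i ∈ Finset.range n, c ^ p ^ (i + 1) • Matrix.vecMul w (B ^ i) := by
        ext k
        simp only [Function.comp_apply, Finset.sum_apply, Pi.smul_apply, smul_eq_mul, map_sum,
          map_mul]
        refine Finset.sum_congr rfl fun i _ ↦ ?_
        rw [RingHom.map_vecMul, hw, hBi, frobenius_def, ← pow_mul, ← pow_succ]
      change Matrix.vecMul (frobenius K p ∘ _) B = _
      rw [hfrob, Matrix.sum_vecMul]
      simp only [Matrix.smul_vecMul, Matrix.vecMul_vecMul, ← pow_succ]
      have h1 := Finset.sum_range_succ (fun i ↦ c ^ p ^ i • Matrix.vecMul w (B ^ i)) n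
      rw [Finset.sum_range_succ'] at h1
      simpa [hc, hBn] using h1
    simpa using hker (Submodule.subset_span hmem)
  obtain ⟨b, hbS, hbspan, hb⟩ := exists_linearIndependent K S
  let basis := Module.Basis.mk hb (by simp [hbspan, hS])
  have : Fintype b := FiniteDimensional.fintypeBasisIndex basis
  have hcard : Fintype.card b = Fintype.card (Fin r) := by
    rw [← Module.finrank_eq_card_basis basis]; simp
  let f := Fintype.equivOfCardEq hcard.symm
  let e : Matrix (Fin r) (Fin r) K := Matrix.of fun i ↦ (f i : Fin r → K)
  refine ⟨e, Matrix.linearIndependent_rows_iff_isUnit.1 (hb.comp f f.injective), ?_⟩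
  ext i j
  exact congr_fun (hbS (f i).2) j

section Lifting

variable {R : Type*} [CommRing R] {ι : Type*}

theorem Matrix.exists_eq_smul_of_forall_mem_span {a : R} {M : Matrix ι ι R}
    (h : ∀ i j, M i j ∈ Ideal.span {a}) : ∃ T : Matrix ι ι R, M = a • T := by
  choose T hT using fun i j ↦ Ideal.mem_span_singleton.1 (h i j)
  exact ⟨T, Matrix.ext hT⟩

variable [Fintype ι] [DecidableEq ι]

theorem RingHom.mapMatrix_smul (φ : R →+* R) (a : R) (M : Matrix ι ι R) :
    φ.mapMatrix (a • M) = φ a • φ.mapMatrix M := by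
  ext; simp

theorem Matrix.isUnit_add_smul {a : R} [IsAdicComplete (Ideal.span {a}) R] {M : Matrix ι ι R}
    (hM : IsUnit M) (T : Matrix ι ι R) : IsUnit (M + a • T) := by
  have := isLocalHom_of_le_jacobson_bot (Ideal.span {a}) (IsAdicComplete.le_jacobson_bot _)
  have hmk : (Ideal.Quotient.mk (Ideal.span {a})).mapMatrix (M + a • T) =
      (Ideal.Quotient.mk (Ideal.span {a})).mapMatrix M := by
    ext i j
    simp [Ideal.Quotient.eq_zero_iff_mem.2 (Ideal.mem_span_singleton_self a)]
  rw [Matrix.isUnit_iff_isUnit_det] at hM ⊢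
  rw [← isUnit_map_iff (Ideal.Quotient.mk (Ideal.span {a})), RingHom.map_det, hmk,
    ← RingHom.map_det]
  exact hM.map _

variable {φ : R →+* R} {a : R} (V : Matrix ι ι R)

theorem exists_mapMatrix_mul_eq_add_pow_succ_smul (ha : φ a = a)
    (hφ : ∀ z, ∃ y, φ y - y - z ∈ Ideal.span {a}) {n : ℕ} {e Z : Matrix ι ι R} (he : IsUnit e)
    (h : φ.mapMatrix e * V = e + a ^ (n + 1) • Z) :
    ∃ T Z' : Matrix ι ι R,
      φ.mapMatrix (e + a ^ (n + 1) • T) * V = e + a ^ (n + 1) • T + a ^ (n + 2) • Z' := by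
  obtain ⟨e, rfl⟩ := he
  choose y hy using hφ
  let A : Matrix ι ι R := -(Z * (↑e⁻¹ : Matrix ι ι R))
  let Y : Matrix ι ι R := A.map y
  obtain ⟨Q, hQ⟩ := Matrix.exists_eq_smul_of_forall_mem_span
    (M := φ.mapMatrix Y - Y - A) fun i j ↦ hy (A i j)
  have hA : A * e = -Z := by simp [A, mul_assoc]
  have hφY : φ.mapMatrix Y * e = Y * e - Z + a • (Q * e) := by
    have := congr_arg (· * (e : Matrix ι ι R)) hQ
    simp only [sub_mul, hA, Matrix.smul_mul] at this
    rw [← this]; abel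
  refine ⟨Y * e, Q * e + a ^ n • (φ.mapMatrix Y * Z), ?_⟩
  rw [map_add, add_mul, h, RingHom.mapMatrix_smul, map_mul, map_pow, ha, Matrix.smul_mul,
    Matrix.mul_assoc, h, mul_add, hφY, Matrix.mul_smul]
  module

theorem exists_isUnit_mapMatrix_mul_eq [IsAdicComplete (Ideal.span {a}) R] (ha : φ a = a)
    (hφ : ∀ z, ∃ y, φ y - y - z ∈ Ideal.span {a}) {e₀ Z₀ : Matrix ι ι R} (he₀ : IsUnit e₀)
    (h₀ : φ.mapMatrix e₀ * V = e₀ + a • Z₀) :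
    ∃ e : Matrix ι ι R, IsUnit e ∧ φ.mapMatrix e * V = e := by
  let P (n : ℕ) (e : Matrix ι ι R) : Prop :=
    IsUnit e ∧ ∃ Z, φ.mapMatrix e * V = e + a ^ (n + 1) • Z
  have step (n : ℕ) (e : {e // P n e}) : ∃ e' : {e // P (n + 1) e}, ∃ T : Matrix ι ι R,
      e'.1 = e.1 + a ^ (n + 1) • T := by
    obtain ⟨e, he, Z, hZ⟩ := e
    obtain ⟨T, Z', h⟩ := exists_mapMatrix_mul_eq_add_pow_succ_smul V ha hφ he hZ
    refine ⟨⟨e + a ^ (n + 1) • T, ?_, Z', h⟩, T, rfl⟩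
    rw [pow_succ', mul_smul]
    exact Matrix.isUnit_add_smul he _
  choose next hnext using step
  let E (n : ℕ) : {e // P n e} :=
    Nat.rec ⟨e₀, he₀, Z₀, by simpa using h₀⟩ (fun n e ↦ next n e) n
  have hE (n : ℕ) : ∃ T : Matrix ι ι R, (E (n + 1)).1 = (E n).1 + a ^ (n + 1) • T := hnext n (E n)
  have hcauchy {m n : ℕ} (hmn : m ≤ n) : ∃ T : Matrix ι ι R, (E n).1 = (E m).1 + a ^ m • T := by
    induction n, hmn using Nat.le_induction with
    | base => exact ⟨0, by simp⟩
    | succ n hmn ih =>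
      obtain ⟨T, hT⟩ := ih
      obtain ⟨T', hT'⟩ := hE n
      obtain ⟨d, hd⟩ : ∃ d, n + 1 = m + d := Nat.exists_eq_add_of_le (by omega)
      exact ⟨T + a ^ d • T', by rw [hT', hT, hd, pow_add]; module⟩
  have hlim (i j : ι) := IsPrecomplete.prec (I := Ideal.span {a}) (M := R) inferInstance
    (f := fun n ↦ (E n).1 i j) fun {m n} hmn ↦ by
      obtain ⟨T, hT⟩ := hcauchy hmn
      rw [SModEq.comm, SModEq.sub_mem, hT, smul_eq_mul, Ideal.mul_top, Ideal.span_singleton_pow,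
        Ideal.mem_span_singleton]
      exact ⟨T i j, by simp⟩
  choose L hL using hlim
  have hlimit (n : ℕ) : ∃ T : Matrix ι ι R, Matrix.of L = (E n).1 + a ^ n • T := by
    obtain ⟨T, hT⟩ := Matrix.exists_eq_smul_of_forall_mem_span (a := a ^ n)
      (M := Matrix.of L - (E n).1) fun i j ↦ by
        simpa [SModEq.sub_mem, Ideal.span_singleton_pow] using (hL i j n).symm
    exact ⟨T, by rw [← hT]; abel⟩
  refine ⟨Matrix.of L, ?_, ?_⟩
  · obtain ⟨T, hT⟩ := hlimit 1
    rw [hT, pow_one]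
    exact Matrix.isUnit_add_smul (E 1).2.1 T
  · ext i j
    rw [← sub_eq_zero]
    refine IsHausdorff.haus (I := Ideal.span {a}) (M := R) inferInstance _ fun n ↦ ?_
    obtain ⟨T, hT⟩ := hlimit n
    obtain ⟨Z, hZ⟩ := (E n).2.2
    rw [SModEq.zero, smul_eq_mul, Ideal.mul_top, Ideal.span_singleton_pow,
      Ideal.mem_span_singleton]
    refine ⟨(a • Z + φ.mapMatrix T * V - T) i j, ?_⟩
    suffices φ.mapMatrix (Matrix.of L) * V - Matrix.of L =
        a ^ n • (a • Z + φ.mapMatrix T * V - T) from congr_fun (congr_fun this i) j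
    rw [hT, map_add, RingHom.mapMatrix_smul, add_mul, hZ, map_pow, ha, Matrix.smul_mul]
    module

end Lifting

open Polynomial in
theorem exists_pow_sub_self_eq {K : Type*} [Field K] [IsAlgClosed K] {p : ℕ} (hp : 1 < p) (z : K) :
    ∃ y : K, y ^ p - y = z := by
  have hdeg : (X ^ p - X - C z : K[X]).natDegree = p := by
    rw [natDegree_sub_C, FiniteField.X_pow_card_sub_X_natDegree_eq K hp]
  obtain ⟨y, hy⟩ := IsAlgClosed.exists_root (X ^ p - X - C z : K[X]) fun h ↦ by
    have := natDegree_eq_zero_iff_degree_le_zero.2 h.le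
    omega
  exact ⟨y, by simpa [sub_eq_zero] using hy⟩

/-- The reduction of `GL_r(ℤ_p)` modulo `p` is a finite group, so the image of a matrix has finite
order in `GL_r(k̄)`. -/
theorem exists_pow_map_constantCoeff_eq_one (p : ℕ) [Fact p.Prime] {r : ℕ}
    (u : GL (Fin r) ℤ_[p]) :
    ∃ B : Matrix (Fin r) (Fin r) (AlgebraicClosure (ZMod p)), ∃ n, 0 < n ∧
      (constantCoeff.mapMatrix (Matrix.GeneralLinearGroup.map (padicToWittBar p) u).1 = B) ∧
      B.map (frobenius _ p) = B ∧ B ^ n = 1 := by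
  let ρ : ℤ_[p] →+* ZMod p := constantCoeff.comp (WittVector.equiv p).symm.toRingHom
  let g : GL (Fin r) (ZMod p) := Matrix.GeneralLinearGroup.map ρ u
  let ι := algebraMap (ZMod p) (AlgebraicClosure (ZMod p))
  refine ⟨ι.mapMatrix g.1, orderOf g, orderOf_pos g, ?_, ?_, ?_⟩
  · ext i j
    simp [g, ρ, ι, constantCoeff]
  · ext i j
    simp [frobenius_def, ← map_pow, ZMod.pow_card]
  · rw [← map_pow, ← Units.val_pow_eq_pow_val, pow_orderOf_eq_one, Units.val_one, map_one]

/-- Over an algebraically closed field `k`, a trivialization of a matrix over `W(k)` modulo `p`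
lifts to a trivialization over `W(k)`. -/
theorem WittVector.exists_isUnit_mapMatrix_frobenius_mul_eq {k : Type*} [Field k] [IsAlgClosed k]
    {p : ℕ} [Fact p.Prime] [CharP k p] {r : ℕ} (V : Matrix (Fin r) (Fin r) (WittVector p k))
    {e : Matrix (Fin r) (Fin r) k} (he : IsUnit e)
    (hV : e.map (_root_.frobenius k p) * constantCoeff.mapMatrix V = e) :
    ∃ ε : Matrix (Fin r) (Fin r) (WittVector p k), IsUnit ε ∧
      (WittVector.map (_root_.frobenius k p)).mapMatrix ε * V = ε := by
  set φ : WittVector p k →+* WittVector p k := WittVector.map (_root_.frobenius k p)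
  let e₀ : Matrix (Fin r) (Fin r) (WittVector p k) := e.map (teichmuller p)
  have hcoeff : constantCoeff.mapMatrix e₀ = e := by
    ext i j
    simp [e₀, constantCoeff]
  have he₀ : IsUnit e₀ := by
    rw [Matrix.isUnit_iff_isUnit_det] at he ⊢
    refine isUnit_of_coeff_zero_ne_zero _ ?_
    change constantCoeff e₀.det ≠ 0
    rw [RingHom.map_det, hcoeff]
    exact he.ne_zero
  have hφ (x : WittVector p k) : constantCoeff (φ x) = _root_.frobenius k p (constantCoeff x) :=
    map_coeff (_root_.frobenius k p) x 0
  have hmap : constantCoeff.mapMatrix (φ.mapMatrix e₀) = e.map (_root_.frobenius k p) := by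
    ext i j
    rw [← hcoeff]
    exact hφ _
  have hzero : constantCoeff.mapMatrix (φ.mapMatrix e₀ * V - e₀) = 0 := by
    rw [map_sub, map_mul, hcoeff, hmap, hV, sub_self]
  obtain ⟨Z₀, hZ₀⟩ := Matrix.exists_eq_smul_of_forall_mem_span (a := (p : WittVector p k))
    (M := φ.mapMatrix e₀ * V - e₀) fun i j ↦ by
      rw [← ker_constantCoeff, RingHom.mem_ker]
      exact congr_fun (congr_fun hzero i) j
  refine exists_isUnit_mapMatrix_mul_eq V (a := (p : WittVector p k)) (map_natCast φ p)
    (fun z ↦ ?_) he₀ (sub_eq_iff_eq_add'.1 hZ₀)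
  obtain ⟨y, hy⟩ := exists_pow_sub_self_eq (Fact.out : p.Prime).one_lt (constantCoeff z)
  refine ⟨teichmuller p y, ?_⟩
  rw [← ker_constantCoeff, RingHom.mem_ker, map_sub, map_sub, hφ, ← hy]
  simp [constantCoeff, frobenius_def]

/-- For `u ∈ GL_r(ℤ_p)` with image `U ∈ GL_r(W(k̄))`, there exists `ε ∈ GL_r(W(k̄))`
with `φ(ε)⁻¹·ε = U⁻¹`, where `φ` is the Frobenius acting entrywise. -/
theorem exists_frobenius_trivialization (p : ℕ) [Fact p.Prime] (r : ℕ) (hr : 1 ≤ r)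
    (u : GL (Fin r) ℤ_[p]) :
    ∃ ε : GL (Fin r) (WittBar p),
      (Matrix.GeneralLinearGroup.map (wittFrob p) ε)⁻¹ * ε =
        (Matrix.GeneralLinearGroup.map (padicToWittBar p) u)⁻¹ := by
  obtain ⟨B, n, hn, hred, hB, hBn⟩ := exists_pow_map_constantCoeff_eq_one p u⁻¹
  obtain ⟨e, he, hBe⟩ := exists_isUnit_map_frobenius_mul_eq p hn B hB hBn
  rw [← hred] at hBe
  obtain ⟨ε, hε, h⟩ := WittVector.exists_isUnit_mapMatrix_frobenius_mul_eq _ he hBe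
  refine ⟨hε.unit, ?_⟩
  exact (inv_mul_eq_of_eq_mul (Units.ext h.symm)).trans
    (map_inv (Matrix.GeneralLinearGroup.map (padicToWittBar p)) u)
end

section
/- Let p be a prime, m, n, r ≥ 1, let k be the finite field with p^m elements, let W_n(k) be the ring of p-typical Witt vectors of length n over k, and let σ : W_n(k) → W_n(k) be the ring automorphism induced functorially by the Frobenius x ↦ x^p of k (acting entrywise on matrices). If A ∈ GL_r(W_n(k)) satisfies A · σ(A) · σ²(A) ⋯ σ^{m−1}(A) = 1, then there exists B ∈ GL_r(W_n(k)) with A = B⁻¹ · σ(B). -/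
open Matrix in
/-- Independence of characters, matrix form: if `φ i` are distinct endomorphisms of a field `K` and
`a i` are square matrices one of which is `1`, then `∑ i, a i * φ i (C)` is invertible for some
matrix `C`. -/
theorem Matrix.exists_isUnit_sum_mul_map {K ι : Type*} [Field K] [Fintype ι] {r : ℕ}
    (φ : ι → K →+* K) (hφ : Function.Injective φ) (a : ι → Matrix (Fin r) (Fin r) K)
    (i₀ : ι) (ha : a i₀ = 1) :
    ∃ C : Matrix (Fin r) (Fin r) K, IsUnit (∑ i, a i * (φ i).mapMatrix C) := by
  set b : (Fin r → K) → (Fin r → K) := fun v => ∑ i, a i *ᵥ (φ i ∘ v) with hb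
  have hindep : LinearIndependent K fun i => ((φ i : K →* K) : K → K) :=
    (linearIndependent_monoidHom K K).comp (fun i => (φ i : K →* K)) fun i j hij =>
      hφ (RingHom.ext fun x => DFunLike.congr_fun hij x)
  have hspan : Submodule.span K (Set.range b) = ⊤ := by
    by_contra hne
    obtain ⟨f, hf0, hf⟩ := Submodule.exists_le_ker_of_lt_top _ (lt_top_iff_ne_top.2 hne)
    refine hf0 (LinearMap.pi_ext' fun j => LinearMap.ext_ring ?_)
    have hsum : ∑ i, f (a i *ᵥ (φ i ∘ Pi.single j 1)) • ((φ i : K →* K) : K → K) = 0 := by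
      funext c
      have hc : f (b (c • Pi.single j 1)) = 0 := hf (Submodule.subset_span ⟨_, rfl⟩)
      have hsmul (i : ι) : φ i ∘ (c • Pi.single j 1 : Fin r → K) =
          φ i c • (φ i ∘ Pi.single j 1) := by
        funext l
        simp
      simp only [hb, map_sum, hsmul, mulVec_smul, map_smul, smul_eq_mul] at hc
      simpa [mul_comm] using hc
    have h₀ := Fintype.linearIndependent_iff.1 hindep _ hsum i₀
    have hsingle : φ i₀ ∘ (Pi.single j 1 : Fin r → K) = Pi.single j 1 := by
      funext l
      by_cases h : l = j <;> simp [h]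
    rwa [ha, hsingle, one_mulVec] at h₀
  obtain ⟨f, hf, -, hli⟩ := Submodule.exists_fun_fin_finrank_span_eq K (Set.range b)
  have hrank : r = Module.finrank K (Submodule.span K (Set.range b)) := by
    rw [hspan, finrank_top, Module.finrank_fin_fun]
  choose v hv using hf
  refine ⟨(Matrix.of fun j => v (Fin.cast hrank j))ᵀ, ?_⟩
  rw [← linearIndependent_cols_iff_isUnit]
  have hcol : (∑ i, a i * (φ i).mapMatrix (Matrix.of fun j => v (Fin.cast hrank j))ᵀ).col =
      f ∘ Fin.cast hrank := by
    funext j l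
    simp [← hv, hb, Matrix.col, Matrix.sum_apply, Finset.sum_apply, Matrix.mul_apply, mulVec,
      dotProduct]
  rw [hcol]
  exact hli.comp _ (Fin.cast_injective hrank)

/-- If `S` is a ring endomorphism with `S^[m] = id` and `A` has trivial norm `A * S A * ⋯ = 1`,
then the sum of `S^[i] C` weighted by the partial norms of `A` is fixed by `x ↦ A * S x`. -/
theorem mul_map_sum_partialNorm {M : Type*} [Ring M] (S : M →+* M) (m : ℕ) (A C : M)
    (hS : S^[m] C = C) (hA : ((List.range m).map fun i => S^[i] A).prod = 1) :
    A * S (∑ i ∈ Finset.range m, ((List.range i).map fun j => S^[j] A).prod * S^[i] C) =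
      ∑ i ∈ Finset.range m, ((List.range i).map fun j => S^[j] A).prod * S^[i] C := by
  set f : ℕ → M := fun i => ((List.range i).map fun j => S^[j] A).prod * S^[i] C with hf
  have hstep (i : ℕ) : A * S (f i) = f (i + 1) := by
    simp only [hf, map_mul, map_list_prod, List.map_map, List.prod_range_succ', ← mul_assoc,
      Function.iterate_succ_apply', Function.iterate_zero, id_eq]
    rfl
  have hends : f m = f 0 := by
    simp only [hf, hA, hS, List.range_zero, List.map_nil, List.prod_nil, Function.iterate_zero,
      id_eq]
  rw [map_sum, Finset.mul_sum, Finset.sum_congr rfl fun i _ => hstep i]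
  exact add_right_cancel
    ((Finset.sum_range_succ' f m).symm.trans (by rw [Finset.sum_range_succ, hends]))

theorem RingHom.mapMatrix_iterate_apply {R : Type*} [CommRing R] {r : ℕ} (σ : R →+* R) (i : ℕ)
    (M : Matrix (Fin r) (Fin r) R) : (σ.mapMatrix)^[i] M = (σ ^ i).mapMatrix M := by
  induction i with
  | zero => ext; simp
  | succ i ih =>
    rw [Function.iterate_succ_apply', ih, pow_succ']
    rfl

/-- Hilbert 90 for `GL_r` of a ring with a finite order automorphism `σ` lifting, along a surjective
local homomorphism to a field, an endomorphism `τ` of the same order. -/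
theorem Matrix.GeneralLinearGroup.exists_eq_inv_mul_map {R K : Type*} [CommRing R] [Field K]
    {r m : ℕ} (hm : 0 < m) (π : R →+* K) [IsLocalHom π] (hπ : Function.Surjective π)
    (σ : R →+* R) (τ : K →+* K) (hστ : π.comp σ = τ.comp π) (hσ : σ ^ m = 1)
    (hτ : Function.Injective fun i : Fin m => τ ^ (i : ℕ)) (A : GL (Fin r) R)
    (hA : ((List.range m).map fun i => (Matrix.GeneralLinearGroup.map σ)^[i] A).prod = 1) :
    ∃ B : GL (Fin r) R, A = B⁻¹ * Matrix.GeneralLinearGroup.map σ B := by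
  set S : Matrix (Fin r) (Fin r) R →+* Matrix (Fin r) (Fin r) R := σ.mapMatrix
  have hcoe (i : ℕ) : (((Matrix.GeneralLinearGroup.map σ)^[i] A : GL (Fin r) R) :
      Matrix (Fin r) (Fin r) R) = S^[i] A := by
    induction i with
    | zero => rfl
    | succ i ih => rw [Function.iterate_succ_apply', Function.iterate_succ_apply', ← ih]; rfl
  have hnorm : ((List.range m).map fun i => S^[i] (A : Matrix (Fin r) (Fin r) R)).prod = 1 := by
    have h := congrArg (Units.coeHom (Matrix (Fin r) (Fin r) R)) hA
    rw [map_list_prod, List.map_map, map_one] at h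
    simpa only [Function.comp_def, Units.coeHom_apply, hcoe] using h
  have hπσ (i : ℕ) : π.comp (σ ^ i) = (τ ^ i).comp π := by
    induction i with
    | zero => rfl
    | succ i ih =>
      calc π.comp (σ ^ (i + 1)) = (π.comp (σ ^ i)).comp σ := by rw [pow_succ]; rfl
        _ = (τ ^ i).comp (π.comp σ) := by rw [ih, RingHom.comp_assoc]
        _ = (τ ^ (i + 1)).comp π := by rw [hστ, pow_succ]; rfl
  obtain ⟨D, hD⟩ := Matrix.exists_isUnit_sum_mul_map (fun i : Fin m => τ ^ (i : ℕ)) hτ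
    (fun i => π.mapMatrix ((List.range i).map fun j => S^[j] (A : Matrix (Fin r) (Fin r) R)).prod)
    ⟨0, hm⟩ (by simp)
  obtain ⟨C, rfl⟩ : ∃ C, π.mapMatrix C = D :=
    ⟨D.map (Function.surjInv hπ), by ext; simp [Function.surjInv_eq hπ]⟩
  set P := ∑ i ∈ Finset.range m,
    ((List.range i).map fun j => S^[j] (A : Matrix (Fin r) (Fin r) R)).prod * S^[i] C with hP
  have hPunit : IsUnit P := by
    rw [Matrix.isUnit_iff_isUnit_det] at hD ⊢
    refine isUnit_of_map_unit π _ ?_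
    rw [RingHom.map_det]
    convert hD using 2
    rw [hP, Finset.sum_range, map_sum]
    refine Finset.sum_congr rfl fun i _ => ?_
    rw [map_mul, RingHom.mapMatrix_iterate_apply]
    congr 1
    ext k l
    exact RingHom.congr_fun (hπσ i) (C k l)
  have hfix : (A : Matrix (Fin r) (Fin r) R) * S P = P := by
    refine mul_map_sum_partialNorm S m A C ?_ hnorm
    rw [RingHom.mapMatrix_iterate_apply, hσ]
    ext
    rfl
  obtain ⟨u, hu⟩ := hPunit
  refine ⟨u⁻¹, ?_⟩
  rw [map_inv, inv_inv, eq_mul_inv_iff_mul_eq]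
  refine Units.ext ?_
  rw [Units.val_mul, hu, ← hfix, ← hu]
  rfl

theorem FiniteField.injective_frobenius_pow {K : Type*} [Field K] [Fintype K] (p : ℕ)
    [Fact p.Prime] [CharP K p] {m : ℕ} (hK : Fintype.card K = p ^ m) :
    Function.Injective fun i : Fin m => (frobenius K p) ^ (i : ℕ) := by
  intro i j hij
  have hp : 1 < p := (Fact.out : p.Prime).one_lt
  have happ (x : K) : x ^ p ^ (i : ℕ) = x ^ p ^ (j : ℕ) := by
    simpa [RingHom.coe_pow, iterate_frobenius] using RingHom.congr_fun hij x
  have hX : (Polynomial.X ^ p ^ (i : ℕ) : Polynomial K) = Polynomial.X ^ p ^ (j : ℕ) := by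
    refine Polynomial.eq_of_natDegree_lt_card_of_eval_eq _ _ Function.injective_id
      (fun x => by simpa using happ x) ?_
    simp only [Polynomial.natDegree_X_pow, hK, max_lt_iff]
    exact ⟨Nat.pow_lt_pow_right hp i.2, Nat.pow_lt_pow_right hp j.2⟩
  have hdeg := congrArg Polynomial.natDegree hX
  simp only [Polynomial.natDegree_X_pow] at hdeg
  exact Fin.ext (Nat.pow_right_injective hp hdeg)

namespace TruncatedWittVector

variable {p : ℕ} [Fact p.Prime] {n : ℕ} {k : Type*}

/-- The zeroth coefficient of a truncated Witt vector of positive length, as a ring homomorphism. -/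
noncomputable def constantCoeff [CommRing k] (hn : 0 < n) : TruncatedWittVector p n k →+* k :=
  RingHom.liftOfRightInverse (WittVector.truncate n) out truncateFun_out
    ⟨WittVector.constantCoeff, fun x hx => (WittVector.mem_ker_truncate n x).1 hx 0 hn⟩

@[simp]
theorem constantCoeff_truncate [CommRing k] (hn : 0 < n) (x : WittVector p k) :
    constantCoeff hn (WittVector.truncate n x) = x.coeff 0 :=
  RingHom.liftOfRightInverse_comp_apply _ _ _ _ _

theorem constantCoeff_surjective [CommRing k] (hn : 0 < n) :
    Function.Surjective (constantCoeff (p := p) (k := k) hn) := fun x =>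
  ⟨WittVector.truncate n (WittVector.teichmuller p x), by simp⟩

theorem isLocalHom_constantCoeff [Field k] [CharP k p] (hn : 0 < n) :
    IsLocalHom (constantCoeff (p := p) (k := k) hn) where
  map_nonunit x hx := by
    obtain ⟨y, rfl⟩ := WittVector.truncate_surjective p n k x
    rw [constantCoeff_truncate] at hx
    exact (WittVector.isUnit_of_coeff_zero_ne_zero y hx.ne_zero).map _

end TruncatedWittVector



/-- Triviality of the first (nonabelian) cohomology of the cyclic group generated by
Frobenius acting on `GL_r(W_n(𝔽_{p^m}))`: if `σ` is the ring endomorphism of the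
truncated Witt vectors `W_n(𝔽_{p^m})` induced functorially by the Frobenius `x ↦ x^p`
(characterized by compatibility with the truncation map from `W(𝔽_{p^m})`), and
`A ∈ GL_r(W_n(𝔽_{p^m}))` satisfies `A·σ(A)·σ²(A)⋯σ^{m-1}(A) = 1`, then `A = B⁻¹·σ(B)`
for some `B ∈ GL_r(W_n(𝔽_{p^m}))`. -/
theorem truncatedWitt_hilbert90 (p : ℕ) [Fact p.Prime] (m n r : ℕ)
    (hm : 1 ≤ m) (hn : 1 ≤ n) (hr : 1 ≤ r)
    (σ : TruncatedWittVector p n (GaloisField p m) →+* TruncatedWittVector p n (GaloisField p m))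
    (hσ : σ.comp (WittVector.truncate n) =
      (WittVector.truncate n).comp (WittVector.map (frobenius (GaloisField p m) p)))
    (A : GL (Fin r) (TruncatedWittVector p n (GaloisField p m)))
    (hA : ((List.range m).map
        (fun i => (⇑(Matrix.GeneralLinearGroup.map σ))^[i] A)).prod = 1) :
    ∃ B : GL (Fin r) (TruncatedWittVector p n (GaloisField p m)),
      A = B⁻¹ * Matrix.GeneralLinearGroup.map σ B := by
  have : Fintype (GaloisField p m) := Fintype.ofFinite _
  have hcard : Fintype.card (GaloisField p m) = p ^ m := by
    rw [← Nat.card_eq_fintype_card, GaloisField.card p m (by omega)]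
  have := TruncatedWittVector.isLocalHom_constantCoeff (p := p) (k := GaloisField p m) hn
  have hσ_apply (x : WittVector p (GaloisField p m)) : σ (WittVector.truncate n x) =
      WittVector.truncate n (WittVector.map (frobenius (GaloisField p m) p) x) :=
    RingHom.congr_fun hσ x
  refine Matrix.GeneralLinearGroup.exists_eq_inv_mul_map hm (TruncatedWittVector.constantCoeff hn)
    (TruncatedWittVector.constantCoeff_surjective hn) σ (frobenius (GaloisField p m) p) ?_ ?_
    (FiniteField.injective_frobenius_pow p hcard) A hA
  · ext x
    obtain ⟨y, rfl⟩ := WittVector.truncate_surjective p n _ x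
    simp [hσ_apply, WittVector.map_coeff]
  · have hpow (i : ℕ) (x : WittVector p (GaloisField p m)) (j : Fin n) :
        ((σ ^ i) (WittVector.truncate n x)).coeff j = x.coeff j ^ p ^ i := by
      induction i generalizing x with
      | zero => simp
      | succ i ih =>
        rw [pow_succ, RingHom.mul_def, RingHom.comp_apply, hσ_apply, ih, WittVector.map_coeff,
          frobenius_def, ← pow_mul, pow_succ']
    ext x j
    obtain ⟨y, rfl⟩ := WittVector.truncate_surjective p n _ x
    rw [hpow, ← hcard, FiniteField.pow_card, RingHom.one_def, RingHom.id_apply,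
      WittVector.coeff_truncate]
end

section
/- Let K be an algebraically closed field of characteristic p > 0, let q be a power of p, let n ≥ 1, let A and B be n×n matrices over K with B invertible, and let f : K → K^n be a function each of whose components is given by a polynomial in one variable all of whose monomials have degree 0 or degree strictly larger than q. Then the system of equations f(x₁) + A·x^{[q]} + B·x = 0 has a solution x = (x₁,…,x_n) ∈ K^n, where x^{[q]} denotes the vector obtained by raising each component of x to the q-th power. -/
open Polynomial Module

/-- `f : K → W` is a polynomial map (tested on linear functionals) whose coefficient in degree `1`
is `w`. -/
def IsPolynomialWithLinearCoeff {K W : Type*} [Field K] [AddCommGroup W] [Module K W]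
    (f : K → W) (w : W) : Prop :=
  ∀ u : W →ₗ[K] K, ∃ P : K[X], (∀ t, P.eval t = u (f t)) ∧ P.coeff 1 = u w

theorem finrank_inf_ker_of_ne_zero {K W : Type*} [Field K] [AddCommGroup W] [Module K W]
    [FiniteDimensional K W] (U : Submodule K W) (u : W →ₗ[K] K) {x : W} (hx : x ∈ U)
    (hux : u x ≠ 0) : finrank K ↥(U ⊓ LinearMap.ker u) + 1 = finrank K U := by
  have hne : u.domRestrict U ≠ 0 := fun h => hux (by simpa using LinearMap.congr_fun h ⟨x, hx⟩)
  have h := Module.Dual.finrank_ker_add_one_of_ne_zero (f := u.domRestrict U) hne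
  have hmap : (LinearMap.ker (u.domRestrict U)).map U.subtype = U ⊓ LinearMap.ker u := by
    ext z
    simp [and_comm]
  rw [← hmap, Submodule.finrank_map_subtype_eq]
  exact h

theorem finrank_span_image_semilinear_le {K V W : Type*} [Field K] [AddCommGroup V] [Module K V]
    [FiniteDimensional K V] [AddCommGroup W] [Module K W] {σ : K →+* K}
    (A : V →ₛₗ[σ] W) (U : Submodule K V) :
    finrank K (Submodule.span K (Set.image A U)) ≤ finrank K U := by
  let b := Module.finBasis K U
  have hle : Submodule.span K (Set.image A U) ≤
      Submodule.span K (Set.range fun i => A (b i : V)) := by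
    rw [Submodule.span_le]
    rintro _ ⟨y, hy, rfl⟩
    have hsum : y = ∑ i, b.repr ⟨y, hy⟩ i • (b i : V) := by
      have h := congrArg U.subtype (b.sum_repr ⟨y, hy⟩)
      rw [map_sum] at h
      exact h.symm
    rw [hsum, map_sum]
    refine Submodule.sum_mem _ fun i _ => ?_
    rw [map_smulₛₗ]
    exact Submodule.smul_mem _ _ (Submodule.subset_span ⟨i, rfl⟩)
  have : FiniteDimensional K (Submodule.span K (Set.range fun i => A (b i : V))) :=
    FiniteDimensional.span_of_finite K (Set.finite_range _)
  refine (Submodule.finrank_mono hle).trans ?_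
  simpa [Set.finrank] using finrank_range_le_card (R := K) (fun i => A (b i : V))

theorem coeff_one_pow_char_pow {K : Type*} [Field K] (p : ℕ) [CharP K p] {e : ℕ} (he : 1 ≤ e)
    (P : K[X]) : (P ^ p ^ e).coeff 1 = 0 := by
  have h : (derivative (P ^ p ^ e)).coeff 0 = 0 := by
    rw [derivative_pow, Nat.cast_pow, CharP.cast_eq_zero K p, zero_pow (by omega)]
    simp
  simpa [coeff_derivative] using h

theorem exists_isRoot_of_coeff_one_ne_zero {K : Type*} [Field K] [IsAlgClosed K] {P : K[X]}
    (hP : P.coeff 1 ≠ 0) : ∃ t, P.eval t = 0 := by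
  refine IsAlgClosed.exists_root P fun h => hP (coeff_eq_zero_of_degree_lt ?_)
  rw [h]
  exact_mod_cast Nat.zero_lt_one

section Solvability

variable {K V W : Type*} [Field K] [AddCommGroup V] [Module K V] [FiniteDimensional K V]
  [AddCommGroup W] [Module K W] {p : ℕ} [ExpChar K p] {e : ℕ}

/-- Every system `f(t) + A y + B y = 0` of `m + 1` equations in `t` and `m` further unknowns `y`,
with `A` Frobenius-semilinear, `B` linear and invertible linear part, is solvable. -/
def SolvableWithParameter (A : V →ₛₗ[iterateFrobenius K p e] W) (B : V →ₗ[K] W) (m : ℕ) : Prop :=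
  ∀ (U : Submodule K V) (T : Submodule K W) (f : K → W) (w : W),
    finrank K U = m → finrank K T = m + 1 →
    (∀ y ∈ U, A y ∈ T) → (∀ y ∈ U, B y ∈ T) → (∀ t, f t ∈ T) → w ∈ T →
    IsPolynomialWithLinearCoeff f w →
    (∀ s : K, ∀ y ∈ U, s • w + B y = 0 → s = 0 ∧ y = 0) →
    ∃ t, ∃ y ∈ U, f t + A y + B y = 0

/-- The square version: one of the unknowns `y` plays the role of the parameter. -/
theorem SolvableWithParameter.exists_square [CharP K p]
    {A : V →ₛₗ[iterateFrobenius K p e] W} {B : V →ₗ[K] W} {m : ℕ}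
    (h : SolvableWithParameter A B m) (he : 1 ≤ e)
    (U : Submodule K V) (T : Submodule K W) (hU : finrank K U = m + 1)
    (hT : finrank K T = m + 1) (hA : ∀ y ∈ U, A y ∈ T) (hB : ∀ y ∈ U, B y ∈ T)
    (hinj : ∀ y ∈ U, B y = 0 → y = 0) (l : V →ₗ[K] K) {v : V} (hv : v ∈ U) (hlv : l v = 1)
    (f : K → W) (hfT : ∀ t, f t ∈ T) (hf : IsPolynomialWithLinearCoeff f 0) :
    ∃ y ∈ U, f (l y) + A y + B y = 0 := by
  have hdim := finrank_inf_ker_of_ne_zero U l hv (by simp [hlv])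
  obtain ⟨t, y, hy, hty⟩ := h (U ⊓ LinearMap.ker l) T (fun t => f t + A (t • v) + t • B v) (B v)
    (by omega) hT (fun y hy => hA y hy.1) (fun y hy => hB y hy.1)
    (fun t => T.add_mem (T.add_mem (hfT t) (hA _ (U.smul_mem _ hv)))
      (T.smul_mem _ (hB v hv))) (hB v hv)
    (by
      intro u
      obtain ⟨P, hP, hP1⟩ := hf u
      refine ⟨P + X ^ p ^ e * C (u (A v)) + X * C (u (B v)), fun t => ?_, ?_⟩
      · simp only [eval_add, eval_mul, eval_pow, eval_X, eval_C, hP, map_add, map_smulₛₗ,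
          iterateFrobenius_def, RingHom.id_apply, smul_eq_mul]
      · have := coeff_one_pow_char_pow p he (X : K[X])
        rw [coeff_add, coeff_add, coeff_mul_C, this, hP1]
        simp)
    (by
      intro s y hy h0
      have h1 := hinj (s • v + y) (U.add_mem (U.smul_mem _ hv) hy.1) (by simpa using h0)
      have hs : s = 0 := by
        have := congrArg l h1
        have hly : l y = 0 := hy.2
        simpa [hlv, hly] using this
      subst hs
      simpa using h1)
  have hly : l y = 0 := hy.2
  refine ⟨t • v + y, U.add_mem (U.smul_mem _ hv) hy.1, ?_⟩
  have hl : l (t • v + y) = t := by simp [hlv, hly]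
  rw [hl, map_add, map_add, map_smul B, ← hty]
  abel

theorem solvableWithParameter [FiniteDimensional K W] [IsAlgClosed K] [CharP K p] (he : 1 ≤ e)
    (A : V →ₛₗ[iterateFrobenius K p e] W) (B : V →ₗ[K] W) (m : ℕ) :
    SolvableWithParameter A B m := by
  induction m using Nat.strong_induction_on with
  | _ m ih =>
  intro U T f w hU hT hA hB hfT hwT hf hinj
  obtain ⟨x, hxT, hx⟩ : ∃ x ∈ T, x ∉ Submodule.span K (Set.image A U) := by
    by_contra! hle
    have h1 := Submodule.finrank_mono (s := T) (t := Submodule.span K (Set.image A U)) hle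
    have h2 := finrank_span_image_semilinear_le A U
    omega
  obtain ⟨u, hux, hu⟩ := Submodule.exists_le_ker_of_notMem hx
  have huA : ∀ y ∈ U, u (A y) = 0 := fun y hy => hu (Submodule.subset_span ⟨y, hy, rfl⟩)
  have hTdim := finrank_inf_ker_of_ne_zero T u hxT hux
  by_cases huB : ∀ y ∈ U, u (B y) = 0
  · have huw : u w ≠ 0 := by
      intro huw
      let L : K × U →ₗ[K] ↥(T ⊓ LinearMap.ker u) :=
        LinearMap.codRestrict _ ((LinearMap.toSpanSingleton K W w).coprod (B ∘ₗ U.subtype))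
          (fun z => ⟨T.add_mem (T.smul_mem _ hwT) (hB _ z.2.2), by
            simp [huw, huB _ z.2.2]⟩)
      have hL : Function.Injective L := by
        rw [injective_iff_map_eq_zero]
        rintro ⟨s, y⟩ h
        have h0 : s • w + B y = 0 := congrArg Subtype.val h
        obtain ⟨hs, hy⟩ := hinj s y y.2 h0
        ext
        · exact hs
        · exact hy
      have := LinearMap.finrank_le_finrank_of_injective hL
      rw [Module.finrank_prod, Module.finrank_self] at this
      omega
    obtain ⟨P, hP, hP1⟩ := hf u
    obtain ⟨t, ht⟩ := exists_isRoot_of_coeff_one_ne_zero (hP1 ▸ huw : P.coeff 1 ≠ 0)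
    have hft : f t ∈ T ⊓ LinearMap.ker u := ⟨hfT t, by simpa [hP] using ht⟩
    rcases m with _ | m
    · have hbot : T ⊓ LinearMap.ker u = ⊥ := Submodule.finrank_eq_zero.mp (by omega)
      have hft0 : f t = 0 := by simpa [hbot] using hft
      exact ⟨t, 0, U.zero_mem, by simp [hft0]⟩
    · obtain ⟨v, hvU, hv⟩ := U.exists_mem_ne_zero_of_ne_bot (by
        rintro rfl
        simp at hU)
      obtain ⟨l, hlv⟩ := Projective.exists_dual_eq_one K hv
      obtain ⟨y, hy, hy0⟩ := (ih m (by omega)).exists_square he U (T ⊓ LinearMap.ker u) hU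
        (by omega) (fun y hy => ⟨hA y hy, huA y hy⟩) (fun y hy => ⟨hB y hy, huB y hy⟩)
        (fun y hy h => (hinj 0 y hy (by simpa using h)).2) l hvU hlv (fun _ => f t)
        (fun _ => hft) (fun u => ⟨C (u (f t)), by simp, by simp⟩)
      exact ⟨t, y, hy, hy0⟩
  · push Not at huB
    obtain ⟨v₀, hv₀U, hv₀⟩ := huB
    obtain ⟨v, hvU, hv⟩ : ∃ v ∈ U, u (B v) = 1 :=
      ⟨(u (B v₀))⁻¹ • v₀, U.smul_mem _ hv₀U, by simp [hv₀]⟩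
    have hUdim := finrank_inf_ker_of_ne_zero U (u ∘ₗ B) hvU (by simp [hv])
    obtain ⟨P, hP, hP1⟩ := hf u
    obtain ⟨t, y, hy, hty⟩ := ih (m - 1) (by omega) (U ⊓ LinearMap.ker (u ∘ₗ B))
      (T ⊓ LinearMap.ker u) (fun t => f t - A (u (f t) • v) - u (f t) • B v) (w - u w • B v)
      (by omega) (by omega) (fun y hy => ⟨hA y hy.1, huA y hy.1⟩)
      (fun y hy => ⟨hB y hy.1, hy.2⟩)
      (fun t => ⟨T.sub_mem (T.sub_mem (hfT t) (hA _ (U.smul_mem _ hvU)))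
        (T.smul_mem _ (hB v hvU)), by simp [hv, huA v hvU]⟩)
      ⟨T.sub_mem hwT (T.smul_mem _ (hB v hvU)), by simp [hv]⟩
      (by
        intro u'
        obtain ⟨Q, hQ, hQ1⟩ := hf u'
        refine ⟨Q - P ^ p ^ e * C (u' (A v)) - P * C (u' (B v)), fun t => ?_, ?_⟩
        · simp [hP, hQ, iterateFrobenius_def]
        · rw [coeff_sub, coeff_sub, coeff_mul_C, coeff_mul_C, coeff_one_pow_char_pow p he,
            hP1, hQ1]
          simp)
      (by
        intro s y hy h0
        obtain ⟨hs, h1⟩ := hinj s (y - (s * u w) • v) (U.sub_mem hy.1 (U.smul_mem _ hvU)) (by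
          rw [← h0, map_sub, map_smul, smul_sub, mul_smul]
          abel)
        subst hs
        simpa using h1)
    refine ⟨t, y - u (f t) • v, U.sub_mem hy.1 (U.smul_mem _ hvU), ?_⟩
    rw [map_sub, map_sub, map_smul B, ← hty]
    abel

end Solvability

/-- Over an algebraically closed field `K` of characteristic `p > 0`, for `q = p^e` a power
of `p`, matrices `A, B` with `B` invertible, and `f : K → K^n` whose components are
polynomials all of whose monomials have degree `0` or degree `> q`, the system
`f(x₁) + A·x^[q] + B·x = 0` has a solution `x ∈ K^n`. -/
theorem alg_closed_char_p_system_solvable (p : ℕ) (hp : p.Prime)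
    (K : Type*) [Field K] [IsAlgClosed K] [CharP K p]
    (e : ℕ) (he : 1 ≤ e) (n : ℕ) (hn : 1 ≤ n)
    (A B : Matrix (Fin n) (Fin n) K) (hB : IsUnit B)
    (g : Fin n → Polynomial K)
    (hg : ∀ i : Fin n, ∀ j : ℕ, 1 ≤ j → j ≤ p ^ e → (g i).coeff j = 0) :
    ∃ x : Fin n → K,
      (fun i => (g i).eval (x ⟨0, hn⟩)) + A.mulVec (fun i => x i ^ p ^ e) + B.mulVec x = 0 := by
  have : ExpChar K p := ExpChar.prime hp
  let F : (Fin n → K) →ₛₗ[iterateFrobenius K p e] (Fin n → K) :=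
    { toFun := fun x => A.mulVec (fun i => x i ^ p ^ e)
      map_add' := fun x y => by
        rw [← Matrix.mulVec_add]
        congr 1
        ext i
        exact add_pow_expChar_pow (x i) (y i) p e
      map_smul' := fun c x => by
        rw [iterateFrobenius_def, ← Matrix.mulVec_smul]
        congr 1
        ext i
        simp [mul_pow] }
  have hker : ∀ y : Fin n → K, B.mulVecLin y = 0 → y = 0 := fun y hy =>
    Matrix.mulVec_injective_of_isUnit hB (by simpa using hy)
  have hdim : finrank K (⊤ : Submodule K (Fin n → K)) = n - 1 + 1 := by
    rw [finrank_top, Module.finrank_fin_fun]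
    omega
  obtain ⟨x, -, hx⟩ := (solvableWithParameter he F B.mulVecLin (n - 1)).exists_square he ⊤ ⊤
    hdim hdim (by simp) (by simp) (fun y _ => hker y) (LinearMap.proj ⟨0, hn⟩)
    (v := Pi.single ⟨0, hn⟩ 1) (by simp) (by simp) (fun t i => (g i).eval t) (by simp)
    (by
      intro u
      refine ⟨∑ i, g i * C (u fun j => if i = j then 1 else 0), fun t => ?_, ?_⟩
      · rw [eval_finsetSum, LinearMap.pi_apply_eq_sum_univ u]
        refine Finset.sum_congr rfl fun i _ => ?_
        simp
      · rw [finsetSum_coeff, map_zero]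
        refine Finset.sum_eq_zero fun i _ => ?_
        rw [coeff_mul_C, hg i 1 le_rfl (Nat.one_le_pow _ _ hp.pos), zero_mul])
  exact ⟨x, hx⟩
end
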